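/- arXiv:1507.05849 — 9 statements merged into one kernel-verified Lean document; each statement's English description precedes it below -/
import Mathlib

section
/- There exists a sequence of polynomials d_n(X_2, …, X_n) (n ≥ 1) with coefficients in the ring ℤ[1/2] of dyadic rationals, each of degree at most 1 in every variable, such that for every basis A of ℕ and every n ≥ 1: r_{n+1}(A) = d_n(r_2(A), …, r_n(A)) if n+1 ∉ A, and r_{n+1}(A) = d_n(r_2(A), …, r_n(A)) + 2 if n+1 ∈ A (the evaluations being taken in ℚ). -/
open MvPolynomial

/-- The number of `A`-representations of `n`: ordered pairs `(x, y) ∈ A × A` with `x + y = n`. -/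
noncomputable def rCount (A : Set ℕ) (n : ℕ) : ℕ :=
  Set.ncard {q : ℕ × ℕ | q.1 ∈ A ∧ q.2 ∈ A ∧ q.1 + q.2 = n}

/-- `A` is a basis of `ℕ` if every `n` has at least one `A`-representation. -/
def IsBasisN (A : Set ℕ) : Prop := ∀ n : ℕ, 1 ≤ rCount A n

theorem rCount_eq_card (A : Set ℕ) (n : ℕ) [DecidablePred (· ∈ A)] :
    rCount A n =
      ((Finset.HasAntidiagonal.antidiagonal n).filter fun q => q.1 ∈ A ∧ q.2 ∈ A).card := by
  rw [rCount, ← Set.ncard_coe_finset]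
  congr 1
  ext q
  simp only [Set.mem_ofPred_eq, Finset.coe_filter, Finset.HasAntidiagonal.mem_antidiagonal]
  tauto

/-- The only `A`-representations of `n + 1` that can involve an element larger than `n` are
`(0, n + 1)` and `(n + 1, 0)`. -/
theorem rCount_succ_eq {A : Set ℕ} (h : 0 ∈ A) (n : ℕ) [Decidable (n + 1 ∈ A)] :
    rCount A (n + 1) = rCount (A ∩ Set.Iic n) (n + 1) + if n + 1 ∈ A then 2 else 0 := by
  classical
  rw [rCount_eq_card, rCount_eq_card]
  by_cases hn : n + 1 ∈ A
  · rw [if_pos hn, ← Finset.card_pair (a := ((0, n + 1) : ℕ × ℕ)) (b := (n + 1, 0)) (by simp),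
      ← Finset.card_union_of_disjoint]
    · congr 1
      ext ⟨x, y⟩
      simp only [Finset.mem_filter, Finset.HasAntidiagonal.mem_antidiagonal,
        Finset.mem_union, Finset.mem_insert, Finset.mem_singleton, Prod.mk.injEq,
        Set.mem_inter_iff, Set.mem_Iic]
      constructor
      · rintro ⟨hxy, hx, hy⟩
        by_cases h0 : x = 0 ∨ y = 0
        · right; omega
        · left; exact ⟨hxy, ⟨hx, by omega⟩, hy, by omega⟩
      · rintro (⟨hxy, hx, hy⟩ | ⟨rfl, rfl⟩ | ⟨rfl, rfl⟩)
        · exact ⟨hxy, hx.1, hy.1⟩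
        · exact ⟨by simp, h, hn⟩
        · exact ⟨by simp, hn, h⟩
    · rw [Finset.disjoint_left]
      rintro ⟨x, y⟩
      simp only [Finset.mem_filter, Finset.HasAntidiagonal.mem_antidiagonal, Finset.mem_insert,
        Finset.mem_singleton, Prod.mk.injEq, Set.mem_inter_iff, Set.mem_Iic]
      omega
  · rw [if_neg hn, add_zero]
    congr 1
    ext ⟨x, y⟩
    simp only [Finset.mem_filter, Finset.HasAntidiagonal.mem_antidiagonal, Set.mem_inter_iff,
      Set.mem_Iic]
    constructor
    · rintro ⟨hxy, hx, hy⟩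
      have hx' : x ≠ n + 1 := fun e => hn (e ▸ hx)
      have hy' : y ≠ n + 1 := fun e => hn (e ▸ hy)
      exact ⟨hxy, ⟨hx, by omega⟩, hy, by omega⟩
    · rintro ⟨hxy, hx, hy⟩
      exact ⟨hxy, hx.1, hy.1⟩

theorem inter_Iic_succ_of_mem {A : Set ℕ} {n : ℕ} (h : n + 1 ∈ A) :
    A ∩ Set.Iic (n + 1) = insert (n + 1) (A ∩ Set.Iic n) := by
  ext x
  simp only [Set.mem_inter_iff, Set.mem_Iic, Set.mem_insert_iff, Nat.le_succ_iff]
  constructor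
  · tauto
  · rintro (rfl | hx)
    · exact ⟨h, Or.inr rfl⟩
    · tauto

theorem inter_Iic_succ_of_notMem {A : Set ℕ} {n : ℕ} (h : n + 1 ∉ A) :
    A ∩ Set.Iic (n + 1) = A ∩ Set.Iic n := by
  ext x
  simp only [Set.mem_inter_iff, Set.mem_Iic, Nat.le_succ_iff]
  constructor
  · rintro ⟨hx, hle | rfl⟩
    · exact ⟨hx, hle⟩
    · exact absurd hx h
  · tauto

theorem degreeOf_rename_castSucc_last {R : Type*} [CommRing R] {m : ℕ}
    (P : MvPolynomial (Fin m) R) : (rename Fin.castSucc P).degreeOf (Fin.last m) = 0 := by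
  classical
  by_contra h
  obtain ⟨j, -, hj⟩ := mem_vars_rename _ _ (mem_vars_iff_degreeOf_ne_zero.2 h)
  exact (Fin.castSucc_lt_last j).ne hj

/-- Over a ring in which `2` is invertible, every function of `A ∩ {0, …, m + 1}` is a
multilinear polynomial in `r_2(A), …, r_{m+1}(A)`, uniformly in the sets `A ∋ 0, 1`. -/
theorem exists_multilinear_eval_rCount {R : Type*} [CommRing R] [Nontrivial R] [Invertible (2 : R)]
    (m : ℕ)
    (f : Set ℕ → R) :
    ∃ P : MvPolynomial (Fin m) R, (∀ i, P.degreeOf i ≤ 1) ∧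
      ∀ A : Set ℕ, 0 ∈ A → 1 ∈ A →
        eval (fun i : Fin m => (rCount A ((i : ℕ) + 2) : R)) P = f (A ∩ Set.Iic (m + 1)) := by
  classical
  induction m generalizing f with
  | zero =>
    refine ⟨C (f {0, 1}), fun i => i.elim0, fun A h0 h1 => ?_⟩
    rw [eval_C]
    congr 1
    ext x
    simp only [Set.mem_insert_iff, Set.mem_singleton_iff, Set.mem_inter_iff, Set.mem_Iic]
    constructor
    · rintro (rfl | rfl)
      · exact ⟨h0, by omega⟩
      · exact ⟨h1, by omega⟩
    · rintro ⟨-, hx⟩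
      omega
  | succ m ih =>
    set g : Set ℕ → R := fun B => ⅟2 * (f (insert (m + 2) B) - f B) with hg
    obtain ⟨P, hPdeg, hP⟩ := ih fun B => f B - g B * rCount B (m + 2)
    obtain ⟨Q, hQdeg, hQ⟩ := ih g
    refine ⟨rename Fin.castSucc P + rename Fin.castSucc Q * X (Fin.last m), fun i => ?_,
      fun A h0 h1 => ?_⟩
    · refine (degreeOf_add_le _ _ _).trans (max_le ?_ ((degreeOf_mul_le _ _ _).trans ?_))
      · induction i using Fin.lastCases with
        | last => simp [degreeOf_rename_castSucc_last]
        | cast j =>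
          rw [degreeOf_rename_of_injective (Fin.castSucc_injective m)]
          exact hPdeg j
      · induction i using Fin.lastCases with
        | last => simp [degreeOf_rename_castSucc_last]
        | cast j =>
          rw [degreeOf_rename_of_injective (Fin.castSucc_injective m), degreeOf_X,
            if_neg (Fin.castSucc_lt_last j).ne]
          exact hQdeg j
    · have hP' := hP A h0 h1
      have hQ' := hQ A h0 h1
      rw [map_add, map_mul, eval_X, eval_rename, eval_rename]
      simp only [Function.comp_def, Fin.val_castSucc, Fin.val_last]
      rw [hP', hQ', rCount_succ_eq h0 (m + 1)]
      by_cases hm : m + 1 + 1 ∈ A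
      · rw [if_pos hm, inter_Iic_succ_of_mem hm, hg]
        push_cast
        linear_combination
          (f (insert (m + 2) (A ∩ Set.Iic (m + 1))) - f (A ∩ Set.Iic (m + 1))) *
            invOf_mul_self (2 : R)
      · rw [if_neg hm, inter_Iic_succ_of_notMem hm]
        push_cast
        ring

/-- The ring `ℤ[1/2]` of dyadic rationals. -/
def dyadicSubring : Subring ℚ where
  carrier := {q | ∃ (z : ℤ) (j : ℕ), q = (z : ℚ) / 2 ^ j}
  mul_mem' := by
    rintro _ _ ⟨z, j, rfl⟩ ⟨w, k, rfl⟩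
    exact ⟨z * w, j + k, by push_cast; rw [pow_add]; field_simp⟩
  one_mem' := ⟨1, 0, by simp⟩
  add_mem' := by
    rintro _ _ ⟨z, j, rfl⟩ ⟨w, k, rfl⟩
    exact ⟨z * 2 ^ k + w * 2 ^ j, j + k, by push_cast; rw [pow_add]; field_simp⟩
  zero_mem' := ⟨0, 0, by simp⟩
  neg_mem' := by
    rintro _ ⟨z, j, rfl⟩
    exact ⟨-z, j, by push_cast; ring⟩

instance : Invertible (2 : dyadicSubring) where
  invOf := ⟨1 / 2, 1, 1, by norm_num⟩
  invOf_mul_self := Subtype.ext (show (1 / 2 : ℚ) * 2 = 1 by norm_num)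
  mul_invOf_self := Subtype.ext (show (2 : ℚ) * (1 / 2) = 1 by norm_num)

theorem IsBasisN.zero_mem {A : Set ℕ} (hA : IsBasisN A) : 0 ∈ A := by
  obtain ⟨⟨x, y⟩, hx, hy, hxy⟩ := Set.nonempty_of_ncard_ne_zero (Nat.pos_iff_ne_zero.1 (hA 0))
  obtain rfl : x = 0 := by simp only at hxy; omega
  exact hx

theorem IsBasisN.one_mem {A : Set ℕ} (hA : IsBasisN A) : 1 ∈ A := by
  obtain ⟨⟨x, y⟩, hx, hy, hxy⟩ := Set.nonempty_of_ncard_ne_zero (Nat.pos_iff_ne_zero.1 (hA 1))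
  obtain rfl | rfl : x = 1 ∨ y = 1 := by simp only at hxy; omega
  · exact hx
  · exact hy

/-- There is a sequence of polynomials `d n` in the variables `X_2, …, X_n` (encoded with
variable index `i : Fin (n-1)` standing for `X_{i+2}`), with dyadic rational coefficients and
degree at most `1` in each variable, such that for every basis `A` of `ℕ` and every `n ≥ 1`,
`r_{n+1} = d n (r_2, …, r_n)` if `n+1 ∉ A` and `r_{n+1} = d n (r_2, …, r_n) + 2` if `n+1 ∈ A`. -/
theorem stmt_3 :
    ∃ d : (n : ℕ) → MvPolynomial (Fin (n - 1)) ℚ,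
      (∀ n (i : Fin (n - 1)), (d n).degreeOf i ≤ 1) ∧
      (∀ n (m : Fin (n - 1) →₀ ℕ), ∃ (z : ℤ) (j : ℕ), (d n).coeff m = (z : ℚ) / 2 ^ j) ∧
      (∀ A : Set ℕ, IsBasisN A → ∀ n : ℕ, 1 ≤ n →
        (n + 1 ∉ A →
          (rCount A (n + 1) : ℚ) =
            eval (fun i : Fin (n - 1) => (rCount A ((i : ℕ) + 2) : ℚ)) (d n)) ∧
        (n + 1 ∈ A →
          (rCount A (n + 1) : ℚ) =
            eval (fun i : Fin (n - 1) => (rCount A ((i : ℕ) + 2) : ℚ)) (d n) + 2)) := by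
  classical
  choose P hdeg hP using fun n : ℕ =>
    exists_multilinear_eval_rCount (R := dyadicSubring) (n - 1) fun B => (rCount B (n + 1) : _)
  refine ⟨fun n => map dyadicSubring.subtype (P n), fun n i => ?_, fun n m => ?_,
    fun A hA n hn => ?_⟩
  · exact degreeOf_le_iff.2 fun s hs =>
      degreeOf_le_iff.1 (hdeg n i) s (support_map_subset _ _ hs)
  · rw [coeff_map]
    exact ((P n).coeff m).2
  · have hev : eval (fun i : Fin (n - 1) => (rCount A ((i : ℕ) + 2) : ℚ))
        (map dyadicSubring.subtype (P n)) = rCount (A ∩ Set.Iic n) (n + 1) := by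
      have h := congrArg dyadicSubring.subtype (hP n A hA.zero_mem hA.one_mem)
      rw [Nat.sub_add_cancel hn, map_natCast, map_eval] at h
      simpa [Function.comp_def] using h
    simp only [hev, rCount_succ_eq hA.zero_mem n]
    exact ⟨fun h => by simp [h], fun h => by simp [h]⟩
end

section
/- There exists a sequence of compliform polynomials e_n(X_2, …, X_n) (n ≥ 1) such that: for every commutative ring R and every sequence a : ℕ → R with a_0 = a_1 = 1 and a_k² = a_k for all k ≥ 2, setting c_n = Σ_{0 ≤ k ≤ n/2} a_k · a_{n−k}, one has c_{n+1} = a_{n+1} + e_n(c_2, …, c_n) for every n ≥ 1. -/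
open MvPolynomial

/-- `cSeq a n = Σ_{0 ≤ k ≤ n/2} a_k · a_{n−k}`. -/
def cSeq {R : Type*} [CommRing R] (a : ℕ → R) (n : ℕ) : R :=
  ∑ k ∈ Finset.range (n / 2 + 1), a k * a (n - k)

/-- The subring generated by the first `m` terms of a sequence. -/
def initialAdjoin {R : Type*} [CommRing R] (b : ℕ → R) (m : ℕ) : Subalgebra ℤ R :=
  Algebra.adjoin ℤ (b '' Set.Iio m)

/-- The additive span of the squarefree monomials in the first `m` terms of a sequence. -/
def squarefreeSpan {R : Type*} [CommRing R] (b : ℕ → R) (m : ℕ) : Submodule ℤ R :=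
  Submodule.span ℤ (Set.range fun s : Finset (Fin m) => ∏ i ∈ s, b i)

section Reduction

variable {R : Type*} [CommRing R] {b : ℕ → R}

theorem initialAdjoin_mono {m n : ℕ} (h : m ≤ n) : initialAdjoin b m ≤ initialAdjoin b n :=
  Algebra.adjoin_mono (Set.image_mono (Set.Iio_subset_Iio h))

theorem mem_initialAdjoin {i m : ℕ} (h : i < m) : b i ∈ initialAdjoin b m :=
  Algebra.subset_adjoin ⟨i, h, rfl⟩

theorem squarefreeSpan_le_succ (m : ℕ) : squarefreeSpan b m ≤ squarefreeSpan b (m + 1) := by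
  refine Submodule.span_le.2 ?_
  rintro _ ⟨s, rfl⟩
  exact Submodule.subset_span ⟨s.map Fin.castSuccEmb, by simp⟩

theorem mul_mem_squarefreeSpan_succ {m : ℕ} {x : R} (hx : x ∈ squarefreeSpan b m) :
    x * b m ∈ squarefreeSpan b (m + 1) := by
  induction hx using Submodule.span_induction with
  | mem x hx =>
    obtain ⟨s, rfl⟩ := hx
    refine Submodule.subset_span ⟨insert (Fin.last m) (s.map Fin.castSuccEmb), ?_⟩
    simp [Finset.prod_insert, Fin.castSucc_ne_last, mul_comm]
  | zero => simp
  | add x y _ _ hx hy => rw [add_mul]; exact add_mem hx hy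
  | smul z x _ hx => rw [smul_mul_assoc]; exact Submodule.smul_mem _ _ hx

theorem exists_eq_add_mul_of_mem_initialAdjoin_succ {m : ℕ}
    (h : ∃ u ∈ initialAdjoin b m, ∃ v ∈ initialAdjoin b m, b m ^ 2 = u + v * b m)
    {z : R} (hz : z ∈ initialAdjoin b (m + 1)) :
    ∃ x ∈ initialAdjoin b m, ∃ y ∈ initialAdjoin b m, z = x + y * b m := by
  obtain ⟨u, hu, v, hv, huv⟩ := h
  induction hz using Algebra.adjoin_induction with
  | mem z hz =>
    obtain ⟨i, hi, rfl⟩ := hz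
    rcases (Nat.lt_succ_iff.1 hi).lt_or_eq with hi | rfl
    · exact ⟨b i, mem_initialAdjoin hi, 0, zero_mem _, by simp⟩
    · exact ⟨0, zero_mem _, 1, one_mem _, by simp⟩
  | algebraMap r => exact ⟨_, Subalgebra.algebraMap_mem _ r, 0, zero_mem _, by simp⟩
  | add z w _ _ hz hw =>
    obtain ⟨x, hx, y, hy, rfl⟩ := hz
    obtain ⟨x', hx', y', hy', rfl⟩ := hw
    exact ⟨x + x', add_mem hx hx', y + y', add_mem hy hy', by ring⟩
  | mul z w _ _ hz hw =>
    obtain ⟨x, hx, y, hy, rfl⟩ := hz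
    obtain ⟨x', hx', y', hy', rfl⟩ := hw
    refine ⟨x * x' + y * y' * u, add_mem (mul_mem hx hx') (mul_mem (mul_mem hy hy') hu),
      x * y' + x' * y + y * y' * v,
      add_mem (add_mem (mul_mem hx hy') (mul_mem hx' hy)) (mul_mem (mul_mem hy hy') hv), ?_⟩
    linear_combination y * y' * huv

theorem mem_squarefreeSpan_of_mem_initialAdjoin
    (h : ∀ m, ∃ u ∈ initialAdjoin b m, ∃ v ∈ initialAdjoin b m, b m ^ 2 = u + v * b m)
    {m : ℕ} {z : R} (hz : z ∈ initialAdjoin b m) : z ∈ squarefreeSpan b m := by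
  induction m generalizing z with
  | zero =>
    have hz' : z ∈ (⊥ : Subalgebra ℤ R) := by simpa [initialAdjoin] using hz
    obtain ⟨r, rfl⟩ := Algebra.mem_bot.1 hz'
    rw [Algebra.algebraMap_eq_smul_one]
    exact Submodule.smul_mem _ _ (Submodule.subset_span ⟨∅, by simp⟩)
  | succ m ih =>
    obtain ⟨x, hx, y, hy, rfl⟩ := exists_eq_add_mul_of_mem_initialAdjoin_succ (h m) hz
    exact add_mem (squarefreeSpan_le_succ m (ih hx)) (mul_mem_squarefreeSpan_succ (ih hy))

theorem exists_compliform_of_mem_squarefreeSpan {m : ℕ} {z : R} (hz : z ∈ squarefreeSpan b m) :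
    ∃ p : MvPolynomial (Fin m) ℤ, (∀ i, p.degreeOf i ≤ 1) ∧
      z = aeval (fun i : Fin m => b i) p := by
  obtain ⟨w, rfl⟩ := (Submodule.mem_span_range_iff_exists_fun ℤ).1 hz
  refine ⟨∑ s, C (w s) * ∏ i ∈ s, X i, fun i => ?_, by simp [map_sum, map_prod]⟩
  refine (degreeOf_sum_le _ _ _).trans (Finset.sup_le fun s _ => ?_)
  refine (degreeOf_C_mul_le _ _ _).trans ((degreeOf_prod_le _ _ _).trans ?_)
  simp only [degreeOf_X, Finset.sum_ite_eq]
  split_ifs <;> simp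

end Reduction

section Convolution

variable {R : Type*} [CommRing R] {a : ℕ → R}

theorem cSeq_succ_succ (h0 : a 0 = 1) (m : ℕ) :
    cSeq a (m + 2) =
      a (m + 2) + ∑ k ∈ Finset.range (m / 2 + 1), a (k + 1) * a (m + 2 - (k + 1)) := by
  rw [cSeq, Finset.sum_range_succ', show (m + 2) / 2 = m / 2 + 1 by omega]
  simp [h0, add_comm]

theorem cSeq_sub_mem_initialAdjoin (h0 : a 0 = 1) (h1 : a 1 = 1) (m : ℕ) :
    cSeq a (m + 2) - a (m + 2) ∈ initialAdjoin (fun i => cSeq a (i + 2)) m := by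
  induction m using Nat.strong_induction_on with
  | _ m ih =>
    have mem_of_lt : ∀ j, j < m + 2 → a j ∈ initialAdjoin (fun i => cSeq a (i + 2)) m := by
      rintro (_ | _ | j) hj
      · rw [h0]; exact one_mem _
      · rw [h1]; exact one_mem _
      · have hj' : j < m := by omega
        rw [show a (j + 1 + 1) = cSeq a (j + 2) - (cSeq a (j + 2) - a (j + 2)) by ring]
        exact sub_mem (mem_initialAdjoin (b := fun i => cSeq a (i + 2)) hj')
          (initialAdjoin_mono hj'.le (ih j hj'))
    rw [cSeq_succ_succ h0, add_sub_cancel_left]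
    refine sum_mem fun k hk => ?_
    have hk' := Finset.mem_range.1 hk
    exact mul_mem (mem_of_lt _ (by omega)) (mem_of_lt _ (by omega))

theorem exists_compliform_cSeq (h0 : a 0 = 1) (h1 : a 1 = 1)
    (ha : ∀ k : ℕ, 2 ≤ k → a k ^ 2 = a k) (m : ℕ) :
    ∃ p : MvPolynomial (Fin m) ℤ, (∀ i, p.degreeOf i ≤ 1) ∧
      cSeq a (m + 2) - a (m + 2) = aeval (fun i : Fin m => cSeq a ((i : ℕ) + 2)) p := by
  refine exists_compliform_of_mem_squarefreeSpan (b := fun i => cSeq a (i + 2))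
    (mem_squarefreeSpan_of_mem_initialAdjoin (fun k => ?_) (cSeq_sub_mem_initialAdjoin h0 h1 m))
  have hf := cSeq_sub_mem_initialAdjoin h0 h1 k
  refine ⟨-(cSeq a (k + 2) - a (k + 2)) - (cSeq a (k + 2) - a (k + 2)) ^ 2,
    sub_mem (neg_mem hf) (pow_mem hf 2), 1 + 2 * (cSeq a (k + 2) - a (k + 2)),
    add_mem (one_mem _) (mul_mem (ofNat_mem _ 2) hf), ?_⟩
  linear_combination ha (k + 2) (by omega)

theorem map_cSeq {S : Type*} [CommRing S] (φ : R →+* S) (n : ℕ) :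
    φ (cSeq a n) = cSeq (fun k => φ (a k)) n := by
  simp [cSeq]

theorem map_aeval_int {S σ : Type*} [CommRing S] (φ : R →+* S) (c : σ → R)
    (p : MvPolynomial σ ℤ) : φ (aeval c p) = aeval (fun i => φ (c i)) p :=
  comp_aeval_apply c φ.toIntAlgHom p

end Convolution

/-- The relations making the variables idempotent and the first two of them equal to `1`. -/
noncomputable def idempotentRelations : Ideal (MvPolynomial ℕ ℤ) :=
  Ideal.span ({X 0 - 1, X 1 - 1} ∪ Set.range fun k => X k ^ 2 - X k)

/-- The universal sequence of idempotents starting with `1, 1`. -/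
noncomputable def universalIdempotent (k : ℕ) : MvPolynomial ℕ ℤ ⧸ idempotentRelations :=
  Ideal.Quotient.mk _ (X k)

theorem universalIdempotent_zero : universalIdempotent 0 = 1 :=
  Ideal.Quotient.eq.2 (Ideal.subset_span (by simp))

theorem universalIdempotent_one : universalIdempotent 1 = 1 :=
  Ideal.Quotient.eq.2 (Ideal.subset_span (by simp))

theorem universalIdempotent_sq (k : ℕ) : universalIdempotent k ^ 2 = universalIdempotent k :=
  Ideal.Quotient.eq.2 (Ideal.subset_span (Or.inr ⟨k, rfl⟩))

theorem exists_ringHom_universalIdempotent {R : Type*} [CommRing R] {a : ℕ → R}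
    (h0 : a 0 = 1) (h1 : a 1 = 1) (ha : ∀ k : ℕ, 2 ≤ k → a k ^ 2 = a k) :
    ∃ φ : MvPolynomial ℕ ℤ ⧸ idempotentRelations →+* R, ∀ k, φ (universalIdempotent k) = a k := by
  have hker : idempotentRelations ≤ RingHom.ker (aeval (R := ℤ) a).toRingHom := by
    refine Ideal.span_le.2 ?_
    rintro _ ((rfl | rfl) | ⟨k, rfl⟩)
    · simp [RingHom.mem_ker, h0]
    · simp [RingHom.mem_ker, h1]
    · rcases k with _ | _ | k
      · simp [RingHom.mem_ker, h0]
      · simp [RingHom.mem_ker, h1]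
      · simp [RingHom.mem_ker, ha (k + 2) (by omega)]
  exact ⟨Ideal.Quotient.lift _ _ hker, fun k => aeval_X a k⟩

/-- There is a sequence of compliform polynomials `e n` in the variables `X_2, …, X_n`
(encoded with variable index `i : Fin (n-1)` standing for `X_{i+2}`) such that for every
commutative ring `R` and every sequence `a : ℕ → R` with `a 0 = a 1 = 1` and `a k` idempotent
for `k ≥ 2`, putting `c n = Σ_{0 ≤ k ≤ n/2} a_k a_{n-k}` one has
`c (n+1) = a (n+1) + e n (c 2, …, c n)` for all `n ≥ 1`. -/
theorem stmt_4 :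
    ∃ e : (n : ℕ) → MvPolynomial (Fin (n - 1)) ℤ,
      (∀ n (i : Fin (n - 1)), (e n).degreeOf i ≤ 1) ∧
      (∀ (R : Type*) [CommRing R] (a : ℕ → R), a 0 = 1 → a 1 = 1 →
        (∀ k : ℕ, 2 ≤ k → a k ^ 2 = a k) →
        ∀ n : ℕ, 1 ≤ n →
          cSeq a (n + 1) =
            a (n + 1) + aeval (fun i : Fin (n - 1) => cSeq a ((i : ℕ) + 2)) (e n)) := by
  choose p hp hc using exists_compliform_cSeq universalIdempotent_zero universalIdempotent_one
    fun k _ => universalIdempotent_sq k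
  refine ⟨fun n => p (n - 1), fun n => hp (n - 1), ?_⟩
  rintro R _ a h0 h1 ha (_ | m) hn
  · omega
  obtain ⟨φ, hφ⟩ := exists_ringHom_universalIdempotent h0 h1 ha
  have h := congrArg φ (hc m)
  rw [map_sub, map_aeval_int] at h
  simp only [map_cSeq, hφ] at h
  exact sub_eq_iff_eq_add'.1 h
end

section
/- There exists a sequence of compliform polynomials e_n(X_2, …, X_n) (n ≥ 1) such that for every subset A ⊆ ℕ with 0 ∈ A and 1 ∈ A, and every n ≥ 1: p_{n+1}(A) = e_n(p_2(A), …, p_n(A)) + 1 if n+1 ∈ A, and p_{n+1}(A) = e_n(p_2(A), …, p_n(A)) if n+1 ∉ A. -/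
open MvPolynomial

/-- The number of `A`-presentations of `n`: ordered pairs `(x, y) ∈ A × A` with
`x + y = n` and `x ≤ y`. -/
noncomputable def pCount (A : Set ℕ) (n : ℕ) : ℕ :=
  Set.ncard {q : ℕ × ℕ | q.1 ∈ A ∧ q.2 ∈ A ∧ q.1 + q.2 = n ∧ q.1 ≤ q.2}

/-- The number of `A`-presentations of `n` depends only on the elements of `A` up to `n`. -/
lemma pCount_congr {A B : Set ℕ} {n : ℕ} (h : ∀ k ≤ n, k ∈ A ↔ k ∈ B) :
    pCount A n = pCount B n := by
  unfold pCount
  congr 1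
  ext ⟨x, y⟩
  simp only [Set.mem_ofPred_eq]
  constructor
  · rintro ⟨hx, hy, hn, hxy⟩
    exact ⟨(h x (by omega)).1 hx, (h y (by omega)).1 hy, hn, hxy⟩
  · rintro ⟨hx, hy, hn, hxy⟩
    exact ⟨(h x (by omega)).2 hx, (h y (by omega)).2 hy, hn, hxy⟩

/-- If `0, n ∈ A` and `0 < n`, removing `n` from `A` destroys exactly one presentation of `n`. -/
lemma pCount_eq_pCount_diff_add_one {A : Set ℕ} {n : ℕ} (h0 : 0 ∈ A) (hn : 0 < n) (hA : n ∈ A) :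
    pCount A n = pCount (A \ {n}) n + 1 := by
  unfold pCount
  have hfin : {q : ℕ × ℕ | q.1 ∈ A \ {n} ∧ q.2 ∈ A \ {n} ∧ q.1 + q.2 = n ∧ q.1 ≤ q.2}.Finite := by
    refine ((Set.finite_Iic n).prod (Set.finite_Iic n)).subset ?_
    rintro ⟨x, y⟩ ⟨-, -, hs, -⟩
    simp only [Set.mem_prod, Set.mem_Iic] at hs ⊢
    omega
  rw [← Set.ncard_insert_of_notMem (a := ((0 : ℕ), n)) (hs := hfin)]
  · congr 1
    ext ⟨x, y⟩
    simp only [Set.mem_ofPred_eq, Set.mem_insert_iff, Set.mem_sdiff, Set.mem_singleton_iff,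
      Prod.mk.injEq]
    constructor
    · rintro ⟨hx, hy, hs, hxy⟩
      by_cases h : x = 0
      · left; omega
      · right
        exact ⟨⟨hx, by omega⟩, ⟨hy, by omega⟩, hs, hxy⟩
    · rintro (⟨rfl, rfl⟩ | ⟨hx, hy, hs, hxy⟩)
      · exact ⟨h0, hA, by omega, by omega⟩
      · exact ⟨hx.1, hy.1, hs, hxy⟩
  · simp

/-- Adding a new variable linearly preserves being compliform. -/
lemma degreeOf_rename_castSucc_add_X_last_mul_le {m : ℕ} {p q : MvPolynomial (Fin m) ℤ}
    (hp : ∀ i, p.degreeOf i ≤ 1) (hq : ∀ i, q.degreeOf i ≤ 1) (i : Fin (m + 1)) :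
    (rename Fin.castSucc p + X (Fin.last m) * rename Fin.castSucc q).degreeOf i ≤ 1 := by
  have hlast (r : MvPolynomial (Fin m) ℤ) :
      (rename Fin.castSucc r).degreeOf (Fin.last m) = 0 := by
    by_contra h
    obtain ⟨j, -, hj⟩ := Finset.mem_image.1 (vars_rename _ _ (mem_vars_iff_degreeOf_ne_zero.2 h))
    exact (Fin.castSucc_lt_last j).ne hj
  refine (degreeOf_add_le _ _ _).trans (max_le ?_ ((degreeOf_mul_le _ _ _).trans ?_))
  · induction i using Fin.lastCases with
    | last => simp [hlast]
    | cast j =>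
      rw [degreeOf_rename_of_injective (Fin.castSucc_injective m)]
      exact hp j
  · rw [degreeOf_X]
    induction i using Fin.lastCases with
    | last => simp [hlast]
    | cast j =>
      rw [degreeOf_rename_of_injective (Fin.castSucc_injective m),
        if_neg (Fin.castSucc_lt_last j).ne, zero_add]
      exact hq j

/-- Every integer-valued function of `A ∩ [0, m + 1]`, for `0, 1 ∈ A`, is a compliform polynomial
in the presentation counts of `2, …, m + 1`. -/
lemma exists_compliform_eq_aeval_pCount (m : ℕ) (f : Set ℕ → ℤ)
    (hf : ∀ A B : Set ℕ, (∀ k ≤ m + 1, k ∈ A ↔ k ∈ B) → f A = f B) :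
    ∃ e : MvPolynomial (Fin m) ℤ, (∀ i, e.degreeOf i ≤ 1) ∧
      ∀ A : Set ℕ, 0 ∈ A → 1 ∈ A →
        f A = aeval (fun i : Fin m => (pCount A ((i : ℕ) + 2) : ℤ)) e := by
  induction m generalizing f with
  | zero =>
    refine ⟨C (f {0, 1}), fun i => i.elim0, fun A h0 h1 => ?_⟩
    rw [aeval_C]
    refine hf _ _ fun k hk => ?_
    interval_cases k <;> simp [h0, h1]
  | succ m ih =>
    let g : Set ℕ → ℤ := fun A => f (insert (m + 2) A) - f (A \ {m + 2})
    have hdiff : ∀ A B : Set ℕ, (∀ k ≤ m + 1, k ∈ A ↔ k ∈ B) →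
        ∀ k ≤ m + 2, k ∈ A \ {m + 2} ↔ k ∈ B \ {m + 2} := by
      intro A B h k hk
      rcases eq_or_ne k (m + 2) with rfl | hne
      · simp
      · simp [hne, h k (by omega)]
    have hinsert : ∀ A B : Set ℕ, (∀ k ≤ m + 1, k ∈ A ↔ k ∈ B) →
        ∀ k ≤ m + 2, k ∈ insert (m + 2) A ↔ k ∈ insert (m + 2) B := by
      intro A B h k hk
      rcases eq_or_ne k (m + 2) with rfl | hne
      · simp
      · simp [hne, h k (by omega)]
    have hg : ∀ A B : Set ℕ, (∀ k ≤ m + 1, k ∈ A ↔ k ∈ B) → g A = g B := by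
      intro A B h
      simp only [g]
      rw [hf _ _ (hinsert A B h), hf _ _ (hdiff A B h)]
    obtain ⟨q, hq, hqe⟩ := ih g hg
    obtain ⟨p, hp, hpe⟩ := ih
      (fun A => f (A \ {m + 2}) - (pCount (A \ {m + 2}) (m + 2) : ℤ) * g A) (by
        intro A B h
        rw [hg A B h, hf _ _ (hdiff A B h), pCount_congr (hdiff A B h)])
    refine ⟨_, degreeOf_rename_castSucc_add_X_last_mul_le hp hq, fun A h0 h1 => ?_⟩
    have hcomp : (fun i : Fin (m + 1) => (pCount A ((i : ℕ) + 2) : ℤ)) ∘ Fin.castSucc =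
        fun i : Fin m => (pCount A ((i : ℕ) + 2) : ℤ) := rfl
    rw [map_add, map_mul, aeval_X, aeval_rename, aeval_rename, hcomp, ← hpe A h0 h1,
      ← hqe A h0 h1, Fin.val_last]
    by_cases hA : m + 2 ∈ A
    · rw [pCount_eq_pCount_diff_add_one h0 (by omega) hA]
      simp only [g, Set.insert_eq_of_mem hA]
      push_cast
      ring
    · rw [Set.sdiff_singleton_eq_self hA]
      ring

/-- There is a sequence of compliform polynomials `e n` in the variables `X_2, …, X_n`
(encoded with variable index `i : Fin (n-1)` standing for `X_{i+2}`) such that for every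
`A ⊆ ℕ` containing `0` and `1` and every `n ≥ 1`:
`p_{n+1} = e n (p_2, …, p_n) + 1` if `n+1 ∈ A`, and `p_{n+1} = e n (p_2, …, p_n)` otherwise. -/
theorem stmt_5 :
    ∃ e : (n : ℕ) → MvPolynomial (Fin (n - 1)) ℤ,
      (∀ n (i : Fin (n - 1)), (e n).degreeOf i ≤ 1) ∧
      (∀ A : Set ℕ, 0 ∈ A → 1 ∈ A → ∀ n : ℕ, 1 ≤ n →
        (n + 1 ∈ A →
          (pCount A (n + 1) : ℤ) =
            aeval (fun i : Fin (n - 1) => (pCount A ((i : ℕ) + 2) : ℤ)) (e n) + 1) ∧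
        (n + 1 ∉ A →
          (pCount A (n + 1) : ℤ) =
            aeval (fun i : Fin (n - 1) => (pCount A ((i : ℕ) + 2) : ℤ)) (e n))) := by
  choose e hdeg he using fun n : ℕ =>
    exists_compliform_eq_aeval_pCount (n - 1) (fun A => (pCount (A \ {n + 1}) (n + 1) : ℤ)) (by
      intro A B h
      refine congrArg Nat.cast (pCount_congr fun k hk => ?_)
      rcases eq_or_ne k (n + 1) with rfl | hne
      · simp
      · simp [hne, h k (by omega)])
  refine ⟨e, hdeg, fun A h0 h1 n _ => ⟨fun hA => ?_, fun hA => ?_⟩⟩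
  · rw [← he n A h0 h1, pCount_eq_pCount_diff_add_one h0 (by omega) hA, Nat.cast_add, Nat.cast_one]
  · rw [← he n A h0 h1, Set.sdiff_singleton_eq_self hA]
end

section
/- Let R be a commutative ring, and let (y_n)_{n ≥ 2} and (z_n)_{n ≥ 2} be sequences in R such that y_n² = y_n for all n ≥ 2, and such that z_{m+1} = y_{m+1} + s_m(y_2, …, y_m) for every m ≥ 1, where each s_m is a polynomial with integer coefficients (s_1 being a constant integer). Then there exist compliform polynomials t_n(X_2, …, X_n) such that y_{n+1} = z_{n+1} + t_n(z_2, …, z_n) for every n ≥ 1. -/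
open MvPolynomial

/-- Multiplying by an extra variable preserves having degree at most one in each variable. -/
theorem degreeOf_rename_add_rename_mul_X_last_le_one {k : ℕ} {a b : MvPolynomial (Fin k) ℤ}
    (ha : ∀ i, a.degreeOf i ≤ 1) (hb : ∀ i, b.degreeOf i ≤ 1) (i : Fin (k + 1)) :
    (rename Fin.castSucc a + rename Fin.castSucc b * X (Fin.last k)).degreeOf i ≤ 1 := by
  have hinj : Function.Injective (Fin.castSucc : Fin k → Fin (k + 1)) :=
    Fin.castSucc_injective k
  have hlast (p : MvPolynomial (Fin k) ℤ) :
      (rename Fin.castSucc p).degreeOf (Fin.last k) = 0 := by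
    classical
    rw [← Nat.le_zero, degreeOf_le_iff]
    intro m hm
    rw [support_rename_of_injective hinj, Finset.mem_image] at hm
    obtain ⟨n, -, rfl⟩ := hm
    refine (Finsupp.mapDomain_of_notMem_range _ _ ?_).le
    rintro ⟨j, hj⟩
    exact Fin.castSucc_ne_last j hj
  refine (degreeOf_add_le _ _ _).trans (max_le ?_ ((degreeOf_mul_le _ _ _).trans ?_))
  · induction i using Fin.lastCases with
    | last => simp [hlast]
    | cast j => simpa [degreeOf_rename_of_injective hinj] using ha j
  · induction i using Fin.lastCases with
    | last => simp [hlast]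
    | cast j => simpa [degreeOf_rename_of_injective hinj, degreeOf_X] using hb j

/-- Evaluating at a tuple whose last entry is idempotent, a polynomial is affine in that entry. -/
theorem exists_aeval_eq_add_mul_last {R : Type*} [CommRing R] {v : ℕ → R} {k : ℕ}
    (hv : v k ^ 2 = v k) (p : MvPolynomial (Fin (k + 1)) ℤ) :
    ∃ a b : MvPolynomial (Fin k) ℤ,
      aeval (fun i : Fin (k + 1) => v i) p =
        aeval (fun i : Fin k => v i) a + aeval (fun i : Fin k => v i) b * v k := by
  induction p using MvPolynomial.induction_on with
  | C c => exact ⟨C c, 0, by simp⟩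
  | add p q hp hq =>
    obtain ⟨a, b, hab⟩ := hp
    obtain ⟨a', b', hab'⟩ := hq
    exact ⟨a + a', b + b', by simp only [map_add, hab, hab']; ring⟩
  | mul_X p i hp =>
    obtain ⟨a, b, hab⟩ := hp
    induction i using Fin.lastCases with
    | last =>
      refine ⟨0, a + b, ?_⟩
      simp only [map_mul, map_add, map_zero, aeval_X, hab, Fin.val_last]
      linear_combination aeval (fun i : Fin k => v i) b * hv
    | cast j =>
      refine ⟨a * X j, b * X j, ?_⟩
      simp only [map_mul, aeval_X, hab, Fin.val_castSucc]
      ring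

/-- If `w` is obtained from a sequence of idempotents `v` by a unitriangular polynomial
substitution, then every polynomial in `v` is a polynomial in `w` of degree at most one in each
variable. -/
theorem exists_degreeOf_le_one_aeval_eq {R : Type*} [CommRing R] {v w : ℕ → R}
    (hv : ∀ k, v k ^ 2 = v k)
    (hw : ∀ k, ∃ c : MvPolynomial (Fin k) ℤ, w k = v k + aeval (fun i : Fin k => v i) c)
    {k : ℕ} (p : MvPolynomial (Fin k) ℤ) :
    ∃ q : MvPolynomial (Fin k) ℤ, (∀ i, q.degreeOf i ≤ 1) ∧
      aeval (fun i : Fin k => v i) p = aeval (fun i : Fin k => w i) q := by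
  induction k with
  | zero => exact ⟨p, fun i => i.elim0, by congr 2; exact Subsingleton.elim _ _⟩
  | succ k ih =>
    obtain ⟨a, b, hab⟩ := exists_aeval_eq_add_mul_last (hv k) p
    obtain ⟨c, hc⟩ := hw k
    obtain ⟨q, hq, hq'⟩ := ih (a - b * c)
    obtain ⟨r, hr, hr'⟩ := ih b
    refine ⟨_, degreeOf_rename_add_rename_mul_X_last_le_one hq hr, ?_⟩
    simp only [map_add, map_mul, aeval_rename, aeval_X, Function.comp_def, Fin.val_castSucc,
      Fin.val_last, ← hq', ← hr', hab, map_sub, hc]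
    ring

/-- Let `R` be a commutative ring, `(y_n)` a sequence of elements idempotent from index `2` on,
and `(z_n)` a sequence with `z_{m+1} = y_{m+1} + s_m(y_2, …, y_m)` for all `m ≥ 1`, where each
`s_m` is a polynomial with integer coefficients (variable index `i : Fin (m-1)` stands for
`X_{i+2}`; `s_1` is a constant). Then there are compliform polynomials `t_n` (integer
coefficients, degree at most `1` in each variable) with
`y_{n+1} = z_{n+1} + t_n(z_2, …, z_n)` for all `n ≥ 1`. -/
theorem stmt_6 (R : Type*) [CommRing R] (y z : ℕ → R)
    (hy : ∀ n : ℕ, 2 ≤ n → y n ^ 2 = y n)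
    (s : (m : ℕ) → MvPolynomial (Fin (m - 1)) ℤ)
    (hz : ∀ m : ℕ, 1 ≤ m →
      z (m + 1) = y (m + 1) + aeval (fun i : Fin (m - 1) => y ((i : ℕ) + 2)) (s m)) :
    ∃ t : (n : ℕ) → MvPolynomial (Fin (n - 1)) ℤ,
      (∀ n (i : Fin (n - 1)), (t n).degreeOf i ≤ 1) ∧
      (∀ n : ℕ, 1 ≤ n →
        y (n + 1) = z (n + 1) + aeval (fun i : Fin (n - 1) => z ((i : ℕ) + 2)) (t n)) := by
  have key (n : ℕ) := exists_degreeOf_le_one_aeval_eq (v := fun i => y (i + 2))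
    (w := fun i => z (i + 2)) (fun k => hy (k + 2) (by omega))
    (fun k => ⟨s (k + 1), hz (k + 1) (by omega)⟩) (-s n)
  choose t ht ht' using key
  refine ⟨t, ht, fun n hn => ?_⟩
  rw [← ht' n, hz n hn, map_neg]
  ring
end

section
/- Let R be a commutative ring, and let (y_n)_{n ≥ 2} and (z_n)_{n ≥ 2} be sequences in R such that y_n² = y_n for all n ≥ 2, and such that z_{m+1} = y_{m+1} + s_m(y_2, …, y_m) for every m ≥ 1, where each s_m is a polynomial with integer coefficients (s_1 being a constant integer). Then for every polynomial u(X_2, …, X_n) with integer coefficients there exists a compliform polynomial v(X_2, …, X_n) such that u(y_2, …, y_n) = v(z_2, …, z_n). -/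
open MvPolynomial

/-- If `f k` is idempotent, every polynomial expression in `f 0, …, f k` is affine in `f k`, with
coefficients polynomial in the preceding terms. -/
theorem exists_aeval_eq_add_mul_of_sq_eq {R : Type*} [CommRing R] {f : ℕ → R} {k : ℕ}
    (hf : f k ^ 2 = f k) (u : MvPolynomial (Fin (k + 1)) ℤ) :
    ∃ a b : MvPolynomial (Fin k) ℤ,
      aeval (fun i : Fin (k + 1) => f i) u =
        aeval (fun i : Fin k => f i) a + aeval (fun i : Fin k => f i) b * f k := by
  induction u using MvPolynomial.induction_on with
  | C c => exact ⟨C c, 0, by simp⟩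
  | add p q hp hq =>
    obtain ⟨a, b, h⟩ := hp
    obtain ⟨a', b', h'⟩ := hq
    refine ⟨a + a', b + b', ?_⟩
    simp only [map_add, h, h']
    ring
  | mul_X p i hp =>
    obtain ⟨a, b, h⟩ := hp
    induction i using Fin.lastCases with
    | last =>
      refine ⟨0, a + b, ?_⟩
      simp only [map_add, map_mul, map_zero, aeval_X, h, Fin.val_last]
      linear_combination aeval (fun i : Fin k => f i) b * hf
    | cast j =>
      refine ⟨a * X j, b * X j, ?_⟩
      simp only [map_mul, aeval_X, h, Fin.val_castSucc]
      ring

/-- Adjoining an affine dependence on a new last variable preserves having degree at most one in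
each variable. -/
theorem degreeOf_rename_castSucc_add_mul_X_last_le_one {k : ℕ} {p q : MvPolynomial (Fin k) ℤ}
    (hp : ∀ i, p.degreeOf i ≤ 1) (hq : ∀ i, q.degreeOf i ≤ 1) (i : Fin (k + 1)) :
    (rename Fin.castSucc p + rename Fin.castSucc q * X (Fin.last k)).degreeOf i ≤ 1 := by
  have hlast (r : MvPolynomial (Fin k) ℤ) : (rename Fin.castSucc r).degreeOf (Fin.last k) = 0 := by
    classical
    rw [← Nat.le_zero, degreeOf_le_iff]
    intro m hm
    obtain ⟨n, rfl, -⟩ := coeff_rename_ne_zero _ _ _ (mem_support_iff.mp hm)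
    rw [Finsupp.mapDomain_of_notMem_range]
    rintro ⟨j, hj⟩
    exact (Fin.castSucc_lt_last j).ne hj
  refine (degreeOf_add_le _ _ _).trans (max_le ?_ ((degreeOf_mul_le _ _ _).trans ?_)) <;>
    induction i using Fin.lastCases with
    | last => simp [hlast]
    | cast j =>
      simp [degreeOf_rename_of_injective (Fin.castSucc_injective k), degreeOf_X, hp, hq,
        (Fin.castSucc_lt_last j).ne]

/-- If `g` differs from a sequence `f` of idempotents by polynomials in the preceding terms of `f`,
every polynomial expression in `f` is a compliform expression in `g`. -/
theorem exists_compliform_aeval_eq {R : Type*} [CommRing R] {f g : ℕ → R}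
    (hf : ∀ k, f k ^ 2 = f k) (s : (k : ℕ) → MvPolynomial (Fin k) ℤ)
    (hg : ∀ k, g k = f k + aeval (fun i : Fin k => f i) (s k))
    (k : ℕ) (u : MvPolynomial (Fin k) ℤ) :
    ∃ v : MvPolynomial (Fin k) ℤ, (∀ i, v.degreeOf i ≤ 1) ∧
      aeval (fun i : Fin k => f i) u = aeval (fun i : Fin k => g i) v := by
  induction k with
  | zero =>
    exact ⟨u, fun i => i.elim0, congrArg (fun h : Fin 0 → R => aeval h u) (Subsingleton.elim _ _)⟩
  | succ k ih =>
    obtain ⟨a, b, hab⟩ := exists_aeval_eq_add_mul_of_sq_eq (hf k) u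
    obtain ⟨p, hp, hpa⟩ := ih (a - b * s k)
    obtain ⟨q, hq, hqb⟩ := ih b
    refine ⟨rename Fin.castSucc p + rename Fin.castSucc q * X (Fin.last k),
      degreeOf_rename_castSucc_add_mul_X_last_le_one hp hq, ?_⟩
    have hcomp : (fun i : Fin (k + 1) => g i) ∘ Fin.castSucc = fun i : Fin k => g i := rfl
    rw [map_add, map_mul, aeval_rename, aeval_rename, aeval_X, hcomp, ← hpa, ← hqb, hab,
      Fin.val_last, hg k, map_sub, map_mul]
    ring

/-- Under the hypotheses of the reciprocal-forms proposition (idempotent `y_n`, `n ≥ 2`, and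
`z_{m+1} = y_{m+1} + s_m(y_2, …, y_m)` for `m ≥ 1` with integer-coefficient polynomials `s_m`),
every integer-coefficient polynomial `u(X_2, …, X_n)` evaluated at `(y_2, …, y_n)` equals some
compliform polynomial `v(X_2, …, X_n)` evaluated at `(z_2, …, z_n)`.
Variable index `i : Fin (n-1)` stands for `X_{i+2}`. -/
theorem stmt_7 (R : Type*) [CommRing R] (y z : ℕ → R)
    (hy : ∀ n : ℕ, 2 ≤ n → y n ^ 2 = y n)
    (s : (m : ℕ) → MvPolynomial (Fin (m - 1)) ℤ)
    (hz : ∀ m : ℕ, 1 ≤ m →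
      z (m + 1) = y (m + 1) + aeval (fun i : Fin (m - 1) => y ((i : ℕ) + 2)) (s m)) :
    ∀ n : ℕ, 1 ≤ n → ∀ u : MvPolynomial (Fin (n - 1)) ℤ,
      ∃ v : MvPolynomial (Fin (n - 1)) ℤ,
        (∀ i : Fin (n - 1), v.degreeOf i ≤ 1) ∧
        aeval (fun i : Fin (n - 1) => y ((i : ℕ) + 2)) u =
          aeval (fun i : Fin (n - 1) => z ((i : ℕ) + 2)) v := by
  intro n hn u
  obtain ⟨k, rfl⟩ := Nat.exists_eq_add_of_le' hn
  exact exists_compliform_aeval_eq (f := fun k => y (k + 2)) (g := fun k => z (k + 2))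
    (fun k => hy (k + 2) (Nat.le_add_left 2 k)) (fun k => s (k + 1))
    (fun k => hz (k + 1) (Nat.le_add_left 1 k)) k u
end

section
/- Let u be a polynomial with integer coefficients in the variables X_1, …, X_n. Then u(x_1, …, x_n) = 0 for every choice of values x_i ∈ {0,1} if and only if u belongs to the ideal of ℤ[X_1, …, X_n] generated by the polynomials X_i² − X_i (i = 1, …, n). -/
open MvPolynomial

/-- A polynomial `u ∈ ℤ[X_1, …, X_n]` vanishes at every point with coordinates in `{0, 1}`
if and only if it lies in the ideal generated by the polynomials `X_i² − X_i`. -/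
theorem stmt_9 (n : ℕ) (u : MvPolynomial (Fin n) ℤ) :
    (∀ x : Fin n → ℤ, (∀ i, x i = 0 ∨ x i = 1) → eval x u = 0) ↔
      u ∈ Ideal.span (Set.range fun i : Fin n => (X i) ^ 2 - X i) := by
  constructor
  · intro h
    obtain ⟨c, -, hc⟩ := combinatorial_nullstellensatz_exists_linearCombination
      (fun _ : Fin n => ({0, 1} : Finset ℤ)) (fun _ => by simp) u
      (fun x hx => h x fun i => by simpa using hx i)
    have hprod : (fun i : Fin n => ∏ r ∈ ({0, 1} : Finset ℤ), (X i - C r)) =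
        fun i => (X i : MvPolynomial (Fin n) ℤ) ^ 2 - X i := by
      funext i
      rw [Finset.prod_pair zero_ne_one, C_0, C_1]
      ring
    rw [hprod] at hc
    exact (Finsupp.mem_ideal_span_range_iff_exists_finsupp).2 ⟨c, hc.symm⟩
  · intro hu x hx
    have hle : Ideal.span (Set.range fun i : Fin n => (X i) ^ 2 - X i) ≤
        RingHom.ker (eval x) := by
      rw [Ideal.span_le]
      rintro _ ⟨i, rfl⟩
      rcases hx i with h | h <;> simp [RingHom.mem_ker, h]
    exact hle hu
end

section
/- Let u be a polynomial with integer coefficients in countably many variables X_1, X_2, …, having degree at most 1 in each variable. If u belongs to the ideal generated by the polynomials X_i² − X_i (i ≥ 1), then u = 0. -/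
open MvPolynomial

/-- A polynomial over an integral domain, of degree at most `1` in each variable, which vanishes
at all points with coordinates in `{0, 1}`, is zero. -/
theorem MvPolynomial.eq_zero_of_degreeOf_le_one_of_eval_zero_one {σ R : Type*} [CommRing R]
    [IsDomain R] (p : MvPolynomial σ R) (hdeg : ∀ i, p.degreeOf i ≤ 1)
    (heval : ∀ x : σ → R, (∀ i, x i = 0 ∨ x i = 1) → eval x p = 0) : p = 0 := by
  classical
  obtain ⟨n, f, hf, q, rfl⟩ := exists_fin_rename p
  suffices q = 0 by rw [this, map_zero]
  refine eq_zero_of_eval_zero_at_prod_finset q (fun _ => {0, 1}) (fun i => ?_) fun x hx => ?_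
  · have h := hdeg (f i)
    rw [degreeOf_rename_of_injective hf] at h
    rw [Finset.card_pair zero_ne_one]
    lia
  · have h := heval (Function.extend f x 0) fun i => by
      by_cases hi : ∃ j, f j = i
      · obtain ⟨j, rfl⟩ := hi
        simpa [hf.extend_apply] using hx j
      · simp [Function.extend_apply' _ _ _ hi]
    rwa [eval_rename, Function.extend_comp hf] at h

/-- A polynomial in the ideal generated by the `X_i² − X_i` vanishes at all points with
coordinates in `{0, 1}`. -/
theorem MvPolynomial.eval_eq_zero_of_mem_span_X_sq_sub_X {σ R : Type*} [CommRing R]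
    {p : MvPolynomial σ R} (hp : p ∈ Ideal.span (Set.range fun i : σ => (X i) ^ 2 - X i))
    {x : σ → R} (hx : ∀ i, x i = 0 ∨ x i = 1) : eval x p = 0 := by
  rw [← RingHom.mem_ker]
  refine Ideal.span_le.2 ?_ hp
  rintro _ ⟨i, rfl⟩
  rcases hx i with h | h <;> simp [RingHom.mem_ker, h]

/-- A polynomial with integer coefficients in countably many variables, of degree at most `1`
in each variable, which lies in the ideal generated by the polynomials `X_i² − X_i`, is zero. -/
theorem stmt_10 (u : MvPolynomial ℕ ℤ)
    (hu : ∀ i : ℕ, u.degreeOf i ≤ 1)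
    (hmem : u ∈ Ideal.span (Set.range fun i : ℕ => (X i) ^ 2 - X i)) :
    u = 0 :=
  eq_zero_of_degreeOf_le_one_of_eval_zero_one u hu fun _ hx =>
    eval_eq_zero_of_mem_span_X_sq_sub_X hmem hx
end

section
/- Let A ⊆ ℕ be a basis of ℕ. Then there exists an index n with 2 ≤ n ≤ 6 such that p_n(A) ≥ 2; consequently there exists n with 2 ≤ n ≤ 6 such that r_n(A) ≥ 3. -/
theorem finite_setOf_representations (A : Set ℕ) (n : ℕ) :
    {q : ℕ × ℕ | q.1 ∈ A ∧ q.2 ∈ A ∧ q.1 + q.2 = n}.Finite :=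
  (Set.finite_Iic (n, n)).subset fun _ hq =>
    ⟨(Nat.le_add_right _ _).trans_eq hq.2.2, (Nat.le_add_left _ _).trans_eq hq.2.2⟩

theorem IsBasisN.exists_add_eq {A : Set ℕ} (hA : IsBasisN A) (n : ℕ) :
    ∃ x ∈ A, ∃ y ∈ A, x + y = n := by
  obtain ⟨⟨x, y⟩, hx, hy, hxy⟩ := Set.nonempty_of_ncard_ne_zero (Nat.one_le_iff_ne_zero.mp (hA n))
  exact ⟨x, hx, y, hy, hxy⟩

theorem two_le_pCount {A : Set ℕ} {x y z w n : ℕ} (hx : x ∈ A) (hy : y ∈ A) (hz : z ∈ A)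
    (hw : w ∈ A) (hxy : x + y = n) (hzw : z + w = n) (hxz : x < z) (hle : z ≤ w) :
    2 ≤ pCount A n := by
  have hne : (x, y) ≠ (z, w) := by simp; omega
  rw [← Set.ncard_pair hne]
  refine Set.ncard_le_ncard ?_ ((finite_setOf_representations A n).subset
    fun q hq => ⟨hq.1, hq.2.1, hq.2.2.1⟩)
  rintro q (rfl | rfl)
  · exact ⟨hx, hy, hxy, show x ≤ y by omega⟩
  · exact ⟨hz, hw, hzw, hle⟩

theorem three_le_rCount {A : Set ℕ} {x y z w n : ℕ} (hx : x ∈ A) (hy : y ∈ A) (hz : z ∈ A)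
    (hw : w ∈ A) (hxy : x + y = n) (hzw : z + w = n) (hxz : x < z) (hle : z ≤ w) :
    3 ≤ rCount A n := by
  have hcard : ({(x, y), (y, x), (z, w)} : Set (ℕ × ℕ)).ncard = 3 := by
    refine Set.ncard_eq_three.mpr ⟨(x, y), (y, x), (z, w), ?_, ?_, ?_, rfl⟩ <;>
      rw [Ne, Prod.mk.injEq] <;> omega
  rw [← hcard]
  refine Set.ncard_le_ncard ?_ (finite_setOf_representations A n)
  rintro q (rfl | rfl | rfl)
  · exact ⟨hx, hy, hxy⟩
  · exact ⟨hy, hx, (Nat.add_comm y x).trans hxy⟩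
  · exact ⟨hz, hw, hzw⟩

/-- A basis of `ℕ` has two different presentations of some `n` with `2 ≤ n ≤ 6`. -/
theorem IsBasisN.exists_two_presentations {A : Set ℕ} (hA : IsBasisN A) :
    ∃ n, 2 ≤ n ∧ n ≤ 6 ∧ ∃ x ∈ A, ∃ y ∈ A, ∃ z ∈ A, ∃ w ∈ A,
      x + y = n ∧ z + w = n ∧ x < z ∧ z ≤ w := by
  have h0 : 0 ∈ A := by
    obtain ⟨x, hx, y, hy, h⟩ := hA.exists_add_eq 0
    obtain rfl : x = 0 := by omega
    exact hx
  have h1 : 1 ∈ A := by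
    obtain ⟨x, hx, y, hy, h⟩ := hA.exists_add_eq 1
    obtain rfl | rfl : x = 1 ∨ y = 1 := by omega
    · exact hx
    · exact hy
  by_cases h2 : 2 ∈ A
  · exact ⟨2, by norm_num, by norm_num, 0, h0, 2, h2, 1, h1, 1, h1, by norm_num⟩
  have h3 : 3 ∈ A := by
    obtain ⟨x, hx, y, hy, h⟩ := hA.exists_add_eq 3
    have hx2 : x ≠ 2 := fun e => h2 (e ▸ hx)
    have hy2 : y ≠ 2 := fun e => h2 (e ▸ hy)
    obtain rfl | rfl : x = 3 ∨ y = 3 := by omega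
    · exact hx
    · exact hy
  by_cases h4 : 4 ∈ A
  · exact ⟨4, by norm_num, by norm_num, 0, h0, 4, h4, 1, h1, 3, h3, by norm_num⟩
  have h5 : 5 ∈ A := by
    obtain ⟨x, hx, y, hy, h⟩ := hA.exists_add_eq 5
    have hx2 : x ≠ 2 := fun e => h2 (e ▸ hx)
    have hy2 : y ≠ 2 := fun e => h2 (e ▸ hy)
    have hx4 : x ≠ 4 := fun e => h4 (e ▸ hx)
    have hy4 : y ≠ 4 := fun e => h4 (e ▸ hy)
    obtain rfl | rfl : x = 5 ∨ y = 5 := by omega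
    · exact hx
    · exact hy
  exact ⟨6, by norm_num, by norm_num, 1, h1, 5, h5, 3, h3, 3, h3, by norm_num⟩

/-- For every basis `A` of `ℕ`, some `p_n` with `2 ≤ n ≤ 6` is at least `2`; consequently
some `r_n` with `2 ≤ n ≤ 6` is at least `3`. -/
theorem stmt_14 (A : Set ℕ) (hA : IsBasisN A) :
    (∃ n : ℕ, 2 ≤ n ∧ n ≤ 6 ∧ 2 ≤ pCount A n) ∧
    (∃ n : ℕ, 2 ≤ n ∧ n ≤ 6 ∧ 3 ≤ rCount A n) := by
  obtain ⟨n, h2, h6, x, hx, y, hy, z, hz, w, hw, hxy, hzw, hxz, hle⟩ := hA.exists_two_presentations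
  exact ⟨⟨n, h2, h6, two_le_pCount hx hy hz hw hxy hzw hxz hle⟩,
    ⟨n, h2, h6, three_le_rCount hx hy hz hw hxy hzw hxz hle⟩⟩
end

section
/- Identify subsets of ℕ with points of the product space K = {0,1}^ℕ endowed with the product topology. Let T = {A ⊆ ℕ : r_n(A) ≥ 1 for every n} (the space of bases of ℕ, with the subspace topology from K), and let U = {A ∈ T : the sequence (r_n(A))_{n∈ℕ} is bounded}. Then U is a meager (first category) subset of the topological space T; equivalently, T \ U is comeager (residual) in T. -/
/-- Representation numbers for a point of the product space `{0,1}^ℕ = (ℕ → Bool)`,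
identifying `ω` with the subset `{n | ω n = true}` of `ℕ`. -/
noncomputable def rCountB (ω : ℕ → Bool) (n : ℕ) : ℕ :=
  rCount {m : ℕ | ω m = true} n

/-- The space of bases of `ℕ`, as a subset of the product space `(ℕ → Bool)`
(with the product topology of the discrete two-point space). -/
def basisSpace : Set (ℕ → Bool) := {ω | ∀ n : ℕ, 1 ≤ rCountB ω n}

open Filter Topology

theorem rCountB_eq_sum (ω : ℕ → Bool) (n : ℕ) :
    rCountB ω n = ∑ p ∈ Finset.HasAntidiagonal.antidiagonal n, (ω p.1 && ω p.2).toNat := by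
  have h : {q : ℕ × ℕ | q.1 ∈ {m | ω m = true} ∧ q.2 ∈ {m | ω m = true} ∧ q.1 + q.2 = n} =
      ((Finset.HasAntidiagonal.antidiagonal n).filter fun q => (ω q.1 && ω q.2) = true : Finset (ℕ × ℕ)) := by
    ext q
    simp only [Set.mem_ofPred_eq, Finset.coe_filter, Finset.HasAntidiagonal.mem_antidiagonal,
      Bool.and_eq_true]
    tauto
  rw [rCountB, rCount, h, Set.ncard_coe_finset, Finset.card_filter]
  refine Finset.sum_congr rfl fun q _ => ?_
  cases ω q.1 && ω q.2 <;> rfl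

theorem continuous_rCountB (n : ℕ) : Continuous fun ω : ℕ → Bool => rCountB ω n := by
  simp only [rCountB_eq_sum]
  refine continuous_finsetSum _ fun p _ => ?_
  have hand : Continuous fun b : Bool × Bool => (b.1 && b.2).toNat :=
    continuous_of_discreteTopology
  have hpair : Continuous fun ω : ℕ → Bool => (ω p.1, ω p.2) := by fun_prop
  exact hand.comp hpair

theorem rCountB_mono {ω ω' : ℕ → Bool} (h : ω ≤ ω') (n : ℕ) : rCountB ω n ≤ rCountB ω' n := by
  simp only [rCountB_eq_sum]
  refine Finset.sum_le_sum fun p _ => ?_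
  have h₁ : ω p.1 ≤ ω' p.1 := h p.1
  have h₂ : ω p.2 ≤ ω' p.2 := h p.2
  revert h₁ h₂
  cases ω p.1 <;> cases ω p.2 <;> cases ω' p.1 <;> cases ω' p.2 <;> decide

/-- The set `ω` together with all integers `≥ N`. -/
def addTail (ω : ℕ → Bool) (N k : ℕ) : Bool := ω k || decide (N ≤ k)

theorem le_addTail (ω : ℕ → Bool) (N : ℕ) : ω ≤ addTail ω N := fun _ => Bool.left_le_or _ _

theorem addTail_mem_basisSpace {ω : ℕ → Bool} (h : ω ∈ basisSpace) (N : ℕ) :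
    addTail ω N ∈ basisSpace := fun n => (h n).trans (rCountB_mono (le_addTail ω N) n)

theorem tendsto_addTail (ω : ℕ → Bool) : Tendsto (addTail ω) atTop (𝓝 ω) := by
  refine tendsto_pi_nhds.2 fun k => tendsto_const_nhds.congr' ?_
  filter_upwards [eventually_gt_atTop k] with N hN
  simp [addTail, hN]

theorem lt_rCountB_addTail (ω : ℕ → Bool) (N B : ℕ) :
    B < rCountB (addTail ω N) (2 * N + B) := by
  let f : ℕ → ℕ × ℕ := fun i => (N + i, N + B - i)
  have hf : Set.InjOn f (Finset.range (B + 1)) := fun i _ j _ hij => by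
    have := congrArg Prod.fst hij
    simpa [f] using this
  have hsub : (Finset.range (B + 1)).image f ⊆ Finset.HasAntidiagonal.antidiagonal (2 * N + B) := by
    intro q hq
    obtain ⟨i, hi, rfl⟩ := Finset.mem_image.1 hq
    rw [Finset.mem_range] at hi
    rw [Finset.HasAntidiagonal.mem_antidiagonal]
    simp only [f]
    omega
  rw [rCountB_eq_sum]
  refine lt_of_lt_of_le ?_ (Finset.sum_le_sum_of_subset hsub)
  rw [Finset.sum_image hf, Finset.sum_congr rfl (g := fun _ => 1)]
  · simp
  · intro i hi
    rw [Finset.mem_range] at hi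
    have h₁ : N ≤ N + B - i := by omega
    simp [f, addTail, h₁]

theorem isNowhereDense_rCountB_le (B : ℕ) :
    IsNowhereDense {A : basisSpace | ∀ n : ℕ, rCountB (A : ℕ → Bool) n ≤ B} := by
  have hclosed : IsClosed {A : basisSpace | ∀ n : ℕ, rCountB (A : ℕ → Bool) n ≤ B} := by
    simp only [Set.ofPred_forall]
    exact isClosed_iInter fun n =>
      isClosed_le ((continuous_rCountB n).comp continuous_subtype_val) continuous_const
  rw [hclosed.isNowhereDense_iff, interior_eq_empty_iff_dense_compl]
  intro A
  have ht : Tendsto (fun N => (⟨addTail A N, addTail_mem_basisSpace A.2 N⟩ : basisSpace))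
      atTop (𝓝 A) := tendsto_subtype_rng.2 (tendsto_addTail A)
  refine mem_closure_of_tendsto ht (Eventually.of_forall fun N hN => ?_)
  exact (lt_rCountB_addTail A N B).not_ge (hN (2 * N + B))

/-- In the space `T` of bases of `ℕ`, the set `U` of bases whose representation-number sequence
is bounded is meager (equivalently, its complement is comeager in `T`). -/
theorem stmt_15 :
    IsMeagre {A : basisSpace | ∃ B : ℕ, ∀ n : ℕ, rCountB (A : ℕ → Bool) n ≤ B} := by
  rw [Set.ofPred_exists]
  exact isMeagre_iUnion fun B => (isNowhereDense_rCountB_le B).isMeagre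
end
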